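/- Let R be a commutative ring, let M and N be finite free R-modules, and let φ : M →ₗ[R] N be an R-linear map whose dual map φ.dualMap : Dual R N → Dual R M is surjective. Then the cokernel N ⧸ LinearMap.range φ is a finitely generated projective R-module. -/

import Mathlib

/-- A linear map out of a finite free module whose dual map is surjective has a linear
retraction. -/
theorem LinearMap.exists_leftInverse_of_dualMap_surjective {R : Type*} [CommRing R] {M N : Type*}
    [AddCommGroup M] [Module R M] [Module.Finite R M] [Module.Free R M]
    [AddCommGroup N] [Module R N]
    (φ : M →ₗ[R] N) (hφ : Function.Surjective φ.dualMap) :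
    ∃ r : N →ₗ[R] M, r ∘ₗ φ = LinearMap.id := by
  let b := Module.Free.chooseBasis R M
  choose f hf using fun i => hφ (b.coord i)
  refine ⟨∑ i, (f i).smulRight (b i), LinearMap.ext fun x => ?_⟩
  have hfx (i) : f i (φ x) = b.repr x i := LinearMap.congr_fun (hf i) x
  simp [hfx, b.sum_repr]

/-- The cokernel of a split monomorphism into a projective module is projective. -/
theorem Module.Projective.quotient_range_of_leftInverse {R : Type*} [Ring R] {M N : Type*}
    [AddCommGroup M] [Module R M] [AddCommGroup N] [Module R N] [Module.Projective R N]
    (φ : M →ₗ[R] N) (r : N →ₗ[R] M) (hr : r ∘ₗ φ = LinearMap.id) :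
    Module.Projective R (N ⧸ LinearMap.range φ) := by
  have hle : LinearMap.range φ ≤ LinearMap.ker (LinearMap.id - φ ∘ₗ r) := by
    rintro _ ⟨x, rfl⟩
    have hrx : r (φ x) = x := LinearMap.congr_fun hr x
    simp [hrx]
  refine .of_split ((LinearMap.range φ).liftQ _ hle) (LinearMap.range φ).mkQ ?_
  ext x
  simp

/-- If `φ : M →ₗ[R] N` is a map of finite free modules whose dual map is surjective
(i.e., `φ` is a fiberwise monomorphism), then the cokernel `N ⧸ range φ` is a finitely
generated projective module. -/
theorem coker_of_dualMap_surjective {R : Type*} [CommRing R] {M N : Type*}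
    [AddCommGroup M] [Module R M] [Module.Finite R M] [Module.Free R M]
    [AddCommGroup N] [Module R N] [Module.Finite R N] [Module.Free R N]
    (φ : M →ₗ[R] N) (hφ : Function.Surjective φ.dualMap) :
    Module.Finite R (N ⧸ LinearMap.range φ) ∧
      Module.Projective R (N ⧸ LinearMap.range φ) := by
  obtain ⟨r, hr⟩ := φ.exists_leftInverse_of_dualMap_surjective hφ
  exact ⟨inferInstance, .quotient_range_of_leftInverse φ r hr⟩
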